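/- Let N ∈ ℕ, K > 0, and (ξ, x) ∈ [0,1)² with x not a dyadic rational, and let I_N(x) = [⌊2^N x⌋ 2^{-N}, (⌊2^N x⌋ + 1) 2^{-N}) be the dyadic interval of length 2^{-N} containing x. Then λ({v ∈ I_N(x) : |W(v) − W(x) − ∫_x^v S(ξ, t) dt| ≤ K·2^{-N}}) = 2^{-N} · λ({u ∈ [0,1) : |H(ξ_{-N}, u) − H(ξ_{-N}, x_{-N})| ≤ K·2^{-N/2}}), where λ is Lebesgue measure on ℝ and (ξ_{-N}, x_{-N}) = B^{-N}(ξ, x). -/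

import Mathlib

open Real MeasureTheory Set Filter

noncomputable section

/-- The Euclidean plane. -/
abbrev E2 : Type := EuclideanSpace ℝ (Fin 2)

/-- The unit vector `(cos t, sin t)` in the Euclidean plane. -/
def cs (t : ℝ) : E2 := (WithLp.equiv 2 (Fin 2 → ℝ)).symm ![Real.cos t, Real.sin t]

/-- The vector `(-sin t, cos t)` in the Euclidean plane. -/
def cs' (t : ℝ) : E2 := (WithLp.equiv 2 (Fin 2 → ℝ)).symm ![-Real.sin t, Real.cos t]

/-- The two-dimensional Weierstrass function
`W(x) = ∑_{n≥0} 2^{-n/2} (cos (2π 2^n x), sin (2π 2^n x))`. -/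
def Wfn (x : ℝ) : E2 := ∑' n : ℕ, (2 : ℝ) ^ (-(n : ℝ) / 2) • cs (2 * π * 2 ^ n * x)

/-- `dig j ξ` is the `j`-th binary digit of `ξ`: `⌊2^j ξ⌋ mod 2` (as a real number). -/
def dig (j : ℕ) (ξ : ℝ) : ℝ := ((⌊(2 : ℝ) ^ j * ξ⌋ % 2 : ℤ) : ℝ)

/-- `rho n ξ = ∑_{i=1}^n d_{n+1-i}(ξ) 2^{-i}`. -/
def rho (n : ℕ) (ξ : ℝ) : ℝ := ∑ i ∈ Finset.Icc 1 n, dig (n + 1 - i) ξ / 2 ^ i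

/-- `x` is a dyadic rational. -/
def dyadic (x : ℝ) : Prop := ∃ (k : ℕ) (m : ℤ), x = (m : ℝ) / 2 ^ k

/-- The stable-direction function
`S(ξ,x) = -2π ∑_{n≥1} 2^{-n/2} (-sin (2π(ρ_n(ξ)+x/2^n)), cos (2π(ρ_n(ξ)+x/2^n)))`. -/
def Sfn (ξ x : ℝ) : E2 :=
  (-(2 * π)) • ∑' n : ℕ,
    (2 : ℝ) ^ (-((n : ℝ) + 1) / 2) • cs' (2 * π * (rho (n + 1) ξ + x / 2 ^ (n + 1)))

/-- The function `H` given by the doubly infinite series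
`H(ξ,x) = ∑_{n≥0} 2^{-n/2} ((cos,sin)(2π 2^n x) - (1,0))
        + ∑_{k≥1} 2^{k/2} ((cos,sin)(2π(ρ_k(ξ)+x/2^k)) - (cos,sin)(2π ρ_k(ξ)))`. -/
def Hfn (ξ x : ℝ) : E2 :=
  (∑' n : ℕ, (2 : ℝ) ^ (-(n : ℝ) / 2) •
      (cs (2 * π * 2 ^ n * x) - (WithLp.equiv 2 (Fin 2 → ℝ)).symm ![1, 0]))
  + ∑' k : ℕ, (2 : ℝ) ^ (((k : ℝ) + 1) / 2) •
      (cs (2 * π * (rho (k + 1) ξ + x / 2 ^ (k + 1))) - cs (2 * π * rho (k + 1) ξ))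

/-- The baker transformation `B(ξ,x) = (2ξ mod 1, (⌊2ξ⌋ + x)/2)`. -/
def baker (p : ℝ × ℝ) : ℝ × ℝ :=
  (Int.fract (2 * p.1), ((⌊2 * p.1⌋ : ℝ) + p.2) / 2)

/-- The unit square `[0,1)²`. -/
def usq : Set (ℝ × ℝ) := Ico (0:ℝ) 1 ×ˢ Ico (0:ℝ) 1

/-- The explicit formula for the `N`-th backward iterate of the baker transformation:
`B^{-N}(ξ,x) = (ξ/2^N + ∑_{j=1}^N d_j(x) 2^{-(N+1-j)}, 2^N x mod 1)`. -/
def bakerInvN (N : ℕ) (p : ℝ × ℝ) : ℝ × ℝ :=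
  (p.1 / 2 ^ N + ∑ j ∈ Finset.Icc 1 N, dig j p.2 / 2 ^ (N + 1 - j),
    Int.fract ((2 : ℝ) ^ N * p.2))

lemma norm_cs (t : ℝ) : ‖cs t‖ = 1 := by
  simp [cs, EuclideanSpace.norm_eq, Fin.sum_univ_two]

lemma norm_cs' (t : ℝ) : ‖cs' t‖ = 1 := by
  simp [cs', EuclideanSpace.norm_eq, Fin.sum_univ_two]

lemma hasDerivAt_cs (t : ℝ) : HasDerivAt cs (cs' t) t := by
  have h : HasDerivAt (fun t : ℝ => ![Real.cos t, Real.sin t]) ![-Real.sin t, Real.cos t] t := by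
    rw [hasDerivAt_pi]
    intro i
    fin_cases i
    · simpa using Real.hasDerivAt_cos t
    · simpa using Real.hasDerivAt_sin t
  exact ((PiLp.continuousLinearEquiv 2 ℝ (fun _ : Fin 2 => ℝ)).symm.toContinuousLinearMap.hasFDerivAt.comp_hasDerivAt
    t h)

lemma continuous_cs' : Continuous cs' := by
  refine (PiLp.continuous_toLp 2 (fun _ : Fin 2 => ℝ)).comp (continuous_pi fun i => ?_)
  fin_cases i
  · exact Real.continuous_sin.neg
  · exact Real.continuous_cos

lemma norm_cs_sub_le (a b : ℝ) : ‖cs a - cs b‖ ≤ |a - b| := by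
  simpa using Convex.norm_image_sub_le_of_norm_hasDerivWithin_le
    (fun t _ => (hasDerivAt_cs t).hasDerivWithinAt) (fun t _ => (norm_cs' t).le)
    convex_univ (mem_univ b) (mem_univ a)

lemma cs_add_two_pi_mul_int (t : ℝ) (k : ℤ) : cs (t + 2 * π * k) = cs t := by
  have h : 2 * π * (k : ℝ) = k * (2 * π) := mul_comm _ _
  simp only [cs, h, Real.cos_add_int_mul_two_pi, Real.sin_add_int_mul_two_pi]

lemma summable_two_rpow_neg_half : Summable fun n : ℕ => (2 : ℝ) ^ (-(n : ℝ) / 2) := by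
  have h : (fun n : ℕ => (2 : ℝ) ^ (-(n : ℝ) / 2)) = fun n : ℕ => ((2 : ℝ) ^ (-(1 / 2) : ℝ)) ^ n := by
    funext n
    rw [← Real.rpow_natCast, ← Real.rpow_mul (by norm_num)]
    congr 1
    ring
  rw [h]
  exact summable_geometric_of_lt_one (by positivity)
    (Real.rpow_lt_one_of_one_lt_of_neg (by norm_num) (by norm_num))

lemma summable_two_rpow_neg_succ_half :
    Summable fun n : ℕ => (2 : ℝ) ^ (-((n : ℝ) + 1) / 2) := by
  simpa using (summable_nat_add_iff 1).2 summable_two_rpow_neg_half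

lemma two_rpow_half_div_pow (n : ℕ) :
    (2 : ℝ) ^ (((n : ℝ) + 1) / 2) / 2 ^ (n + 1) = 2 ^ (-((n : ℝ) + 1) / 2) := by
  rw [← Real.rpow_natCast, ← Real.rpow_sub (by norm_num)]
  congr 1
  push_cast
  ring

lemma summable_unstable (c : ℕ → E2) (hc : ∀ n, ‖c n‖ ≤ 2) :
    Summable fun n : ℕ => (2 : ℝ) ^ (-(n : ℝ) / 2) • c n := by
  refine Summable.of_norm_bounded (summable_two_rpow_neg_half.mul_right 2) fun n => ?_
  rw [norm_smul, Real.norm_of_nonneg (by positivity)]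
  gcongr
  exact hc n

lemma summable_stable (ρ : ℕ → ℝ) (u w : ℝ) :
    Summable fun k : ℕ => (2 : ℝ) ^ (((k : ℝ) + 1) / 2) •
      (cs (2 * π * (ρ k + u / 2 ^ (k + 1))) - cs (2 * π * (ρ k + w / 2 ^ (k + 1)))) := by
  refine Summable.of_norm_bounded
    (summable_two_rpow_neg_succ_half.mul_right (2 * π * |u - w|)) fun k => ?_
  rw [norm_smul, Real.norm_of_nonneg (by positivity), ← two_rpow_half_div_pow, div_mul_eq_mul_div,
    mul_div_assoc]
  gcongr
  refine (norm_cs_sub_le _ _).trans_eq ?_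
  rw [show 2 * π * (ρ k + u / 2 ^ (k + 1)) - 2 * π * (ρ k + w / 2 ^ (k + 1))
    = 2 * π * (u - w) / 2 ^ (k + 1) by ring, abs_div, abs_mul,
    abs_of_pos Real.two_pi_pos, abs_of_pos (by positivity : (0 : ℝ) < 2 ^ (k + 1))]

lemma summable_stable_zero (ρ : ℕ → ℝ) (u : ℝ) :
    Summable fun k : ℕ => (2 : ℝ) ^ (((k : ℝ) + 1) / 2) •
      (cs (2 * π * (ρ k + u / 2 ^ (k + 1))) - cs (2 * π * ρ k)) := by
  simpa using summable_stable ρ u 0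

lemma norm_one_zero : ‖((WithLp.equiv 2 (Fin 2 → ℝ)).symm ![1, 0] : E2)‖ = 1 := by
  simp [EuclideanSpace.norm_eq, Fin.sum_univ_two]

lemma Wfn_sub (u w : ℝ) : Wfn u - Wfn w =
    ∑' n : ℕ, (2 : ℝ) ^ (-(n : ℝ) / 2) • (cs (2 * π * 2 ^ n * u) - cs (2 * π * 2 ^ n * w)) := by
  have h (t : ℝ) := summable_unstable (fun n => cs (2 * π * 2 ^ n * t))
    fun n => by rw [norm_cs]; norm_num
  rw [Wfn, Wfn, ← (h u).tsum_sub (h w)]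
  simp only [smul_sub]

lemma Hfn_sub (ξ u w : ℝ) : Hfn ξ u - Hfn ξ w =
    (∑' n : ℕ, (2 : ℝ) ^ (-(n : ℝ) / 2) • (cs (2 * π * 2 ^ n * u) - cs (2 * π * 2 ^ n * w)))
    + ∑' k : ℕ, (2 : ℝ) ^ (((k : ℝ) + 1) / 2) •
      (cs (2 * π * (rho (k + 1) ξ + u / 2 ^ (k + 1)))
        - cs (2 * π * (rho (k + 1) ξ + w / 2 ^ (k + 1)))) := by
  have h (t : ℝ) := summable_unstable
    (fun n => cs (2 * π * 2 ^ n * t) - (WithLp.equiv 2 (Fin 2 → ℝ)).symm ![1, 0])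
    fun n => (norm_sub_le _ _).trans (by rw [norm_cs, norm_one_zero]; norm_num)
  have h' (t : ℝ) := summable_stable_zero (fun k => rho (k + 1) ξ) t
  rw [Hfn, Hfn, add_sub_add_comm, ← (h u).tsum_sub (h w), ← (h' u).tsum_sub (h' w)]
  simp only [← smul_sub, sub_sub_sub_cancel_right]

lemma hasDerivAt_stable_sum (ξ t : ℝ) :
    HasDerivAt (fun t => ∑' k : ℕ, (2 : ℝ) ^ (((k : ℝ) + 1) / 2) •
      (cs (2 * π * (rho (k + 1) ξ + t / 2 ^ (k + 1))) - cs (2 * π * rho (k + 1) ξ)))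
      (-Sfn ξ t) t := by
  have hS : -Sfn ξ t = ∑' n : ℕ, (2 * π) • (2 : ℝ) ^ (-((n : ℝ) + 1) / 2) •
      cs' (2 * π * (rho (n + 1) ξ + t / 2 ^ (n + 1))) := by
    rw [Sfn, neg_smul, neg_neg, tsum_const_smul'']
  rw [hS]
  refine hasDerivAt_tsum
    (g := fun (k : ℕ) (t : ℝ) => (2 : ℝ) ^ (((k : ℝ) + 1) / 2) •
      (cs (2 * π * (rho (k + 1) ξ + t / 2 ^ (k + 1))) - cs (2 * π * rho (k + 1) ξ)))
    (g' := fun (n : ℕ) (t : ℝ) => (2 * π) • (2 : ℝ) ^ (-((n : ℝ) + 1) / 2) •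
      cs' (2 * π * (rho (n + 1) ξ + t / 2 ^ (n + 1))))
    (y₀ := 0) (summable_two_rpow_neg_succ_half.mul_left (2 * π)) (fun n y => ?_)
    (fun n y => ?_) (summable_stable_zero (fun k => rho (k + 1) ξ) 0) t
  · have h1 : HasDerivAt (fun y : ℝ => 2 * π * (rho (n + 1) ξ + y / 2 ^ (n + 1)))
        (2 * π * (1 / 2 ^ (n + 1))) y :=
      (((hasDerivAt_id y).div_const _).const_add _).const_mul _
    have h2 := (((hasDerivAt_cs _).scomp y h1).sub_const
      (cs (2 * π * rho (n + 1) ξ))).const_smul ((2 : ℝ) ^ (((n : ℝ) + 1) / 2))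
    refine h2.congr_deriv ?_
    rw [smul_smul, smul_smul, ← two_rpow_half_div_pow]
    congr 1
    ring
  · rw [norm_smul, norm_smul, norm_cs', Real.norm_of_nonneg (by positivity),
      Real.norm_of_nonneg (by positivity), mul_one]

lemma continuous_Sfn (ξ : ℝ) : Continuous (Sfn ξ) := by
  unfold Sfn
  refine Continuous.const_smul (M := ℝ) (α := E2) (continuous_tsum (fun n => ?_)
    summable_two_rpow_neg_succ_half fun n t => ?_) (-(2 * π))
  · exact (continuous_cs'.comp (by fun_prop :
      Continuous fun t : ℝ => 2 * π * (rho (n + 1) ξ + t / 2 ^ (n + 1)))).const_smul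
        ((2 : ℝ) ^ (-((n : ℝ) + 1) / 2))
  · rw [norm_smul, norm_cs', Real.norm_of_nonneg (by positivity), mul_one]

lemma Wfn_sub_integral_Sfn (ξ x v : ℝ) :
    Wfn v - Wfn x - ∫ t in x..v, Sfn ξ t = Hfn ξ v - Hfn ξ x := by
  have hI := intervalIntegral.integral_eq_sub_of_hasDerivAt
    (fun t _ => hasDerivAt_stable_sum ξ t) ((continuous_Sfn ξ).neg.intervalIntegrable x v)
  have h' (t : ℝ) := summable_stable_zero (fun k => rho (k + 1) ξ) t
  rw [intervalIntegral.integral_neg, ← (h' v).tsum_sub (h' x)] at hI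
  simp only [← smul_sub, sub_sub_sub_cancel_right] at hI
  rw [Hfn_sub, Wfn_sub, ← hI, sub_eq_add_neg]

lemma dig_one_half_add {η : ℝ} (hη : η ∈ Ico (0 : ℝ) 1) (d : ℤ) :
    dig 1 ((η + d) / 2) = ((d % 2 : ℤ) : ℝ) := by
  have h : ⌊(2 : ℝ) ^ 1 * ((η + d) / 2)⌋ = d := by
    rw [show (2 : ℝ) ^ 1 * ((η + d) / 2) = η + d by ring, Int.floor_add_intCast,
      Int.floor_eq_zero_iff.2 hη, zero_add]
  rw [dig, h]

lemma dig_add_two_half_add (η : ℝ) (d : ℤ) (j : ℕ) :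
    dig (j + 2) ((η + d) / 2) = dig (j + 1) η := by
  have h : ⌊(2 : ℝ) ^ (j + 2) * ((η + d) / 2)⌋ = ⌊(2 : ℝ) ^ (j + 1) * η⌋ + 2 * (2 ^ j * d) := by
    rw [← Int.floor_add_intCast]
    congr 1
    push_cast
    ring
  rw [dig, dig, h, Int.add_mul_emod_self_left]

lemma rho_succ_half_add {η : ℝ} (hη : η ∈ Ico (0 : ℝ) 1) {d : ℤ} (hd : d % 2 = d) (n : ℕ) :
    rho (n + 1) ((η + d) / 2) = rho n η + d / 2 ^ (n + 1) := by
  rw [rho, Finset.sum_Icc_succ_top (by omega), show n + 1 + 1 - (n + 1) = 1 by omega,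
    dig_one_half_add hη, hd, rho]
  congr 1
  refine Finset.sum_congr rfl fun i hi => ?_
  rw [Finset.mem_Icc] at hi
  obtain ⟨j, hj⟩ : ∃ j, n = i + j := ⟨n - i, by omega⟩
  rw [show n + 1 + 1 - i = j + 2 by omega, show n + 1 - i = j + 1 by omega, dig_add_two_half_add]

lemma Hfn_sub_half_add {η : ℝ} (hη : η ∈ Ico (0 : ℝ) 1) {d : ℤ} (hd : d % 2 = d) (u w : ℝ) :
    Hfn η ((d + u) / 2) - Hfn η ((d + w) / 2) =
      (2 : ℝ) ^ (-(1 : ℝ) / 2) • (Hfn ((η + d) / 2) u - Hfn ((η + d) / 2) w) := by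
  have hA := summable_unstable
    (fun n => cs (2 * π * 2 ^ n * ((d + u) / 2)) - cs (2 * π * 2 ^ n * ((d + w) / 2)))
    fun n => (norm_sub_le _ _).trans (by rw [norm_cs, norm_cs]; norm_num)
  have hB := summable_stable (fun k => rho (k + 1) ((η + d) / 2)) u w
  rw [Hfn_sub, Hfn_sub, hA.tsum_eq_zero_add, hB.tsum_eq_zero_add, smul_add, smul_add,
    ← tsum_const_smul'', ← tsum_const_smul'', add_comm (_ • _) (tsum _), add_assoc]
  have hcs (n : ℕ) (t : ℝ) : cs (2 * π * 2 ^ (n + 1) * ((d + t) / 2)) = cs (2 * π * 2 ^ n * t) := by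
    rw [← cs_add_two_pi_mul_int (2 * π * 2 ^ n * t) (2 ^ n * d)]
    congr 1
    push_cast
    ring
  have hρ (k : ℕ) (t : ℝ) : rho (k + 1) ((η + d) / 2) + t / 2 ^ (k + 1)
      = rho k η + (d + t) / 2 / 2 ^ k := by
    rw [rho_succ_half_add hη hd]
    ring
  congr 1
  · refine tsum_congr fun n => ?_
    rw [hcs, hcs, smul_smul, ← Real.rpow_add (by norm_num)]
    congr 2
    push_cast
    ring
  · congr 1
    · rw [hρ, hρ, smul_smul, ← Real.rpow_add (by norm_num)]
      norm_num [rho]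
    · refine tsum_congr fun k => ?_
      rw [hρ, hρ, smul_smul, ← Real.rpow_add (by norm_num)]
      congr 2
      push_cast
      ring

lemma bakerInvN_succ_fst (N : ℕ) (ξ x : ℝ) :
    (bakerInvN (N + 1) (ξ, x)).1 = ((bakerInvN N (ξ, x)).1 + dig (N + 1) x) / 2 := by
  simp only [bakerInvN]
  have h : ∑ j ∈ Finset.Icc 1 N, dig j x / (2 : ℝ) ^ (N + 1 + 1 - j)
      = (∑ j ∈ Finset.Icc 1 N, dig j x / (2 : ℝ) ^ (N + 1 - j)) / 2 := by
    rw [Finset.sum_div]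
    refine Finset.sum_congr rfl fun j hj => ?_
    rw [Finset.mem_Icc] at hj
    rw [show N + 1 + 1 - j = N + 1 - j + 1 by omega, pow_succ, div_div]
  rw [Finset.sum_Icc_succ_top (by omega), h, show N + 1 + 1 - (N + 1) = 1 by omega]
  ring

lemma bakerInvN_fst_mem (N : ℕ) {ξ : ℝ} (hξ : ξ ∈ Ico (0 : ℝ) 1) (x : ℝ) :
    (bakerInvN N (ξ, x)).1 ∈ Ico (0 : ℝ) 1 := by
  induction N with
  | zero => simpa [bakerInvN] using hξ
  | succ N ih =>
    have h0 : (0 : ℝ) ≤ dig (N + 1) x := by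
      rw [dig]
      exact_mod_cast Int.emod_nonneg _ two_ne_zero
    have h1 : dig (N + 1) x ≤ 1 := by
      rw [dig]
      exact_mod_cast Int.lt_add_one_iff.1 (Int.emod_lt_of_pos _ two_pos)
    rw [bakerInvN_succ_fst]
    constructor <;> linarith [ih.1, ih.2]

lemma floor_two_pow_succ_mul (N : ℕ) (x : ℝ) :
    ⌊(2 : ℝ) ^ (N + 1) * x⌋ = 2 * ⌊(2 : ℝ) ^ N * x⌋ + ⌊(2 : ℝ) ^ (N + 1) * x⌋ % 2 := by
  have h : ⌊(2 : ℝ) ^ (N + 1) * x⌋ / 2 = ⌊(2 : ℝ) ^ N * x⌋ := by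
    have := Int.floor_div_natCast ((2 : ℝ) ^ (N + 1) * x) 2
    rw [Nat.cast_ofNat, Nat.cast_ofNat] at this
    rw [← this]
    congr 1
    ring
  omega

lemma Hfn_sub_bakerInvN (N : ℕ) {ξ : ℝ} (hξ : ξ ∈ Ico (0 : ℝ) 1) {x : ℝ}
    (hx : x ∈ Ico (0 : ℝ) 1) (u : ℝ) :
    Hfn ξ ((⌊(2 : ℝ) ^ N * x⌋ + u) / 2 ^ N) - Hfn ξ x =
      (2 : ℝ) ^ (-(N : ℝ) / 2) • (Hfn (bakerInvN N (ξ, x)).1 u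
        - Hfn (bakerInvN N (ξ, x)).1 (bakerInvN N (ξ, x)).2) := by
  induction N generalizing u with
  | zero =>
    simp [bakerInvN, Int.floor_eq_zero_iff.2 hx, Int.fract_eq_self.2 hx]
  | succ N ih =>
    set d : ℤ := ⌊(2 : ℝ) ^ (N + 1) * x⌋ % 2 with hd
    have hfl : (⌊(2 : ℝ) ^ (N + 1) * x⌋ : ℝ) = 2 * ⌊(2 : ℝ) ^ N * x⌋ + d := by
      have h := congrArg (Int.cast : ℤ → ℝ) (floor_two_pow_succ_mul N x)
      rwa [← hd, Int.cast_add, Int.cast_mul, Int.cast_ofNat] at h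
    have hv : (⌊(2 : ℝ) ^ (N + 1) * x⌋ + u) / 2 ^ (N + 1)
        = (⌊(2 : ℝ) ^ N * x⌋ + (d + u) / 2) / 2 ^ N := by
      rw [hfl]
      field_simp
      ring
    have hxN : (bakerInvN N (ξ, x)).2 = (d + (bakerInvN (N + 1) (ξ, x)).2) / 2 := by
      simp only [bakerInvN, Int.fract, hfl]
      ring
    rw [hv, ih, hxN, Hfn_sub_half_add (bakerInvN_fst_mem N hξ x) (Int.emod_emod _ _), smul_smul,
      ← Real.rpow_add (by norm_num), bakerInvN_succ_fst]
    congr 2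
    push_cast
    ring

/-- The measure of the part of the graph of `W` in the `K 2^{-N}`-neighborhood of the
stable fiber through `(x, W(x))`, over the dyadic interval `I_N(x)`, equals
`2^{-N} λ({u ∈ [0,1) : |H(ξ_{-N},u) - H(ξ_{-N},x_{-N})| ≤ K 2^{-N/2}})`. -/
theorem measure_graph_near_stable_fiber (N : ℕ) (K : ℝ) (hK : 0 < K)
    (ξ x : ℝ) (hξ : ξ ∈ Ico (0:ℝ) 1) (hx : x ∈ Ico (0:ℝ) 1) (hxd : ¬ dyadic x) :
    volume {v : ℝ | v ∈ Ico ((⌊(2:ℝ) ^ N * x⌋ : ℝ) / 2 ^ N)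
          (((⌊(2:ℝ) ^ N * x⌋ : ℝ) + 1) / 2 ^ N) ∧
        ‖Wfn v - Wfn x - ∫ t in x..v, Sfn ξ t‖ ≤ K * 2 ^ (-(N : ℝ))}
      = (2 : ENNReal)⁻¹ ^ N *
        volume {u : ℝ | u ∈ Ico (0:ℝ) 1 ∧
          ‖Hfn (bakerInvN N (ξ, x)).1 u
              - Hfn (bakerInvN N (ξ, x)).1 (bakerInvN N (ξ, x)).2‖
            ≤ K * 2 ^ (-(N : ℝ) / 2)} := by
  set m : ℤ := ⌊(2:ℝ) ^ N * x⌋ with hm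
  have h2 : (0 : ℝ) < 2 ^ N := by positivity
  set B : Set ℝ := {u : ℝ | u ∈ Ico (0:ℝ) 1 ∧
    ‖Hfn (bakerInvN N (ξ, x)).1 u - Hfn (bakerInvN N (ξ, x)).1 (bakerInvN N (ξ, x)).2‖
      ≤ K * 2 ^ (-(N : ℝ) / 2)} with hB
  have hpre : {v : ℝ | v ∈ Ico ((m : ℝ) / 2 ^ N) (((m : ℝ) + 1) / 2 ^ N) ∧
      ‖Wfn v - Wfn x - ∫ t in x..v, Sfn ξ t‖ ≤ K * 2 ^ (-(N : ℝ))}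
      = ((2 : ℝ) ^ N * ·) ⁻¹' ((· + -(m : ℝ)) ⁻¹' B) := by
    ext v
    have hH := Hfn_sub_bakerInvN N hξ hx (2 ^ N * v + -m)
    rw [← hm, show ((m : ℝ) + (2 ^ N * v + -m)) / 2 ^ N = v by field_simp; ring] at hH
    have hp : (0 : ℝ) < 2 ^ (-(N : ℝ) / 2) := by positivity
    have hK2 : K * (2 : ℝ) ^ (-(N : ℝ)) = 2 ^ (-(N : ℝ) / 2) * (K * 2 ^ (-(N : ℝ) / 2)) := by
      rw [mul_left_comm, ← Real.rpow_add (by norm_num), add_halves]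
    simp only [hB, mem_ofPred_eq, mem_preimage, mem_Ico, Wfn_sub_integral_Sfn, hH, norm_smul,
      Real.norm_of_nonneg hp.le, hK2, mul_le_mul_iff_right₀ hp, div_le_iff₀ h2, lt_div_iff₀ h2]
    refine and_congr_left' (and_congr ?_ ?_) <;> constructor <;> intro h <;> linarith
  rw [hpre, Real.volume_preimage_mul_left h2.ne', measure_preimage_add_right]
  congr 1
  rw [abs_of_pos (inv_pos.2 h2), ENNReal.ofReal_inv_of_pos h2, ENNReal.ofReal_pow (by norm_num),
    ENNReal.inv_pow]
  norm_num

end
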